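/- Let F be a field, let n be a positive integer, and let k ∈ {1, 2, 3, 4}. A matrix M ∈ GL_n(F) can be written as a product of four matrices of GL_n(F), of which k are involutions and 4 − k are U2-matrices (with the factors in any prescribed order), if and only if det M = 1 or det M = −1. -/

import Mathlib

open Polynomial Module

/-- `x` is an involution (for `b = true`) or a U2-element (for `b = false`). -/
def IsFactor {R : Type*} [Ring R] : Bool → R → Prop
  | true, x => x * x = 1
  | false, x => (x - 1) * (x - 1) = 0

/-- `x` is a product of involutions and U2-elements whose types are prescribed by `l`. -/
def HasFactorization {R : Type*} [Ring R] (l : List Bool) (x : R) : Prop :=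
  ∃ xs : List R, List.Forall₂ IsFactor l xs ∧ xs.prod = x

section Factor

variable {R S : Type*} [Ring R] [Ring S]

lemma IsFactor.map {b : Bool} {x : R} (h : IsFactor b x) (f : R →+* S) : IsFactor b (f x) := by
  cases b
  · simpa [IsFactor] using congrArg f h
  · simpa [IsFactor] using congrArg f h

lemma isFactor_one (b : Bool) : IsFactor b (1 : R) := by
  cases b <;> simp [IsFactor]

lemma IsFactor.exists_inverse {b : Bool} {x : R} (h : IsFactor b x) :
    ∃ y, IsFactor b y ∧ x * y = 1 ∧ y * x = 1 := by
  cases b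
  · simp only [IsFactor] at h ⊢
    have h' : x * x = 2 * x - 1 := by
      rw [← sub_eq_zero, ← h]; noncomm_ring
    have h2 : 2 - x - 1 = -(x - 1) := by rw [← one_add_one_eq_two]; abel
    exact ⟨2 - x, by rw [h2, neg_mul_neg, h], by rw [mul_sub, h', mul_two, two_mul]; abel,
      by rw [sub_mul, h']; abel⟩
  · exact ⟨x, h, h, h⟩

lemma IsFactor.conj {b : Bool} {x u v : R} (h : IsFactor b x) (huv : u * v = 1)
    (hvu : v * u = 1) : IsFactor b (u * x * v) := by
  cases b
  · simp only [IsFactor] at h ⊢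
    have : u * x * v - 1 = u * (x - 1) * v := by rw [mul_sub, sub_mul, mul_one, huv]
    rw [this, show u * (x - 1) * v * (u * (x - 1) * v) = u * (x - 1) * (v * u) * ((x - 1) * v) by
      noncomm_ring, hvu, mul_one, mul_assoc u, ← mul_assoc (x - 1), h]
    simp
  · simp only [IsFactor] at h ⊢
    rw [show u * x * v * (u * x * v) = u * x * (v * u) * (x * v) by noncomm_ring, hvu, mul_one,
      mul_assoc u, ← mul_assoc x, h, one_mul, huv]

lemma hasFactorization_pair {a b : Bool} {x : R} :
    HasFactorization [a, b] x ↔ ∃ y z, IsFactor a y ∧ IsFactor b z ∧ y * z = x := by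
  constructor
  · rintro ⟨xs, h, rfl⟩
    cases h with
    | cons h1 h =>
      cases h with
      | cons h2 h =>
        cases h
        exact ⟨_, _, h1, h2, by simp⟩
  · rintro ⟨y, z, hy, hz, rfl⟩
    exact ⟨[y, z], .cons hy (.cons hz .nil), by simp⟩

lemma HasFactorization.append {l l' : List Bool} {x y : R} (hx : HasFactorization l x)
    (hy : HasFactorization l' y) : HasFactorization (l ++ l') (x * y) := by
  obtain ⟨xs, hxs, rfl⟩ := hx
  obtain ⟨ys, hys, rfl⟩ := hy
  exact ⟨xs ++ ys, List.rel_append hxs hys, by simp⟩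

lemma HasFactorization.map {l : List Bool} {x : R} (h : HasFactorization l x) (f : R →+* S) :
    HasFactorization l (f x) := by
  obtain ⟨xs, hxs, rfl⟩ := h
  refine ⟨xs.map f, ?_, by simp [map_list_prod]⟩
  rw [List.forall₂_map_right_iff]
  exact hxs.imp fun _ _ h => h.map f

/-- The order of the factors is irrelevant, since `x * y = y * (y⁻¹ * x * y)`. -/
lemma HasFactorization.perm {l l' : List Bool} (hl : l.Perm l') {x : R}
    (h : HasFactorization l x) : HasFactorization l' x := by
  induction hl generalizing x with
  | nil => exact h
  | cons b _ ih =>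
    obtain ⟨_, h, rfl⟩ := h
    cases h with
    | cons h1 h =>
      obtain ⟨ys, hys, hy⟩ := ih ⟨_, h, rfl⟩
      exact ⟨_ :: ys, .cons h1 hys, by simp [hy]⟩
  | swap a b l =>
    obtain ⟨_, h, rfl⟩ := h
    cases h with
    | cons h1 h =>
      cases h with
      | cons h2 h =>
        obtain ⟨w, -, hw, hw'⟩ := h2.exists_inverse
        refine ⟨_, .cons h2 (.cons (h1.conj hw' hw) h), ?_⟩
        simp only [List.prod_cons, ← mul_assoc, hw, one_mul]
  | trans _ _ ih₁ ih₂ => exact ih₂ (ih₁ h)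

lemma HasFactorization.inverse_pair {b : Bool} {x y : R} (h : HasFactorization [b, b] x)
    (hxy : x * y = 1) : HasFactorization [b, b] y := by
  obtain ⟨u, v, hu, hv, rfl⟩ := hasFactorization_pair.1 h
  obtain ⟨u', hu', hu1, hu2⟩ := hu.exists_inverse
  obtain ⟨v', hv', hv1, hv2⟩ := hv.exists_inverse
  refine hasFactorization_pair.2 ⟨v', u', hv', hu', ?_⟩
  calc v' * u' = v' * u' * (u * v * y) := by rw [hxy, mul_one]
    _ = v' * (u' * u) * v * y := by noncomm_ring
    _ = y := by rw [hu2, mul_one, hv2, one_mul]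

lemma HasFactorization.neg {l : List Bool} {x : R} (h : HasFactorization (true :: l) x) :
    HasFactorization (true :: l) (-x) := by
  obtain ⟨_, h, rfl⟩ := h
  cases h with
  | cons h1 h => exact ⟨_, .cons (b := -_) (by simpa [IsFactor] using h1) h, by simp⟩

lemma HasFactorization.isUnit {l : List Bool} {x : R} (h : HasFactorization l x) : IsUnit x := by
  obtain ⟨xs, h, rfl⟩ := h
  induction h with
  | nil => simp
  | cons h1 _ ih =>
    obtain ⟨y, -, hxy, hyx⟩ := h1.exists_inverse
    rw [List.prod_cons]
    exact IsUnit.mul ⟨⟨_, y, hxy, hyx⟩, rfl⟩ ih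

end Factor

section Cyclic

variable {F V W : Type*} [Field F] [AddCommGroup V] [Module F V] [AddCommGroup W] [Module F W]

/-- `v` is a cyclic vector of the endomorphism `A`. -/
def IsCyclicVector (A : End F V) (v : V) : Prop :=
  ∀ U : Submodule F V, v ∈ U → (∀ x ∈ U, A x ∈ U) → U = ⊤

lemma aeval_mem_of_invariant {A : End F V} {U : Submodule F V} (hA : ∀ x ∈ U, A x ∈ U) {v : V}
    (hv : v ∈ U) (p : F[X]) : aeval A p v ∈ U := by
  induction p using Polynomial.induction_on generalizing v with
  | C a => simpa using U.smul_mem a hv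
  | add p q hp hq => simpa using U.add_mem (hp hv) (hq hv)
  | monomial n a h =>
    rw [pow_succ, ← mul_assoc, map_mul, aeval_X, Module.End.mul_apply]
    exact h (hA _ hv)

lemma IsCyclicVector.exists_aeval {A : End F V} {v : V} (h : IsCyclicVector A v) (x : V) :
    ∃ p : F[X], aeval A p v = x := by
  let φ : F[X] →ₗ[F] V := (LinearMap.applyₗ v).comp (aeval A).toLinearMap
  have hφ : LinearMap.range φ = ⊤ := by
    apply h
    · exact ⟨1, by simp [φ]⟩
    · rintro _ ⟨p, rfl⟩
      exact ⟨X * p, by simp [φ]⟩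
  have : x ∈ LinearMap.range φ := hφ ▸ Submodule.mem_top
  exact this

lemma exists_quotient_equiv_of_isCyclicVector [FiniteDimensional F V] {A : End F V} {v : V}
    (hA : IsCyclicVector A v) {p : F[X]} (hp : p.Monic) (hV : finrank F V = p.natDegree)
    (hpA : aeval A p v = 0) :
    ∃ e : (F[X] ⧸ Ideal.span {p}) ≃ₗ[F] V, ∀ q, e (Ideal.Quotient.mk _ q) = aeval A q v := by
  let φ : F[X] →ₗ[F] V := (LinearMap.applyₗ v).comp (aeval A).toLinearMap
  let ψ : (F[X] ⧸ Ideal.span {p}) →ₗ[F] V :=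
    Submodule.liftQ ((Ideal.span {p}).restrictScalars F) φ (by
      intro q hq
      obtain ⟨r, rfl⟩ := Ideal.mem_span_singleton'.1 hq
      simp [φ, hpA])
  have hψ : ∀ q, ψ (Ideal.Quotient.mk _ q) = aeval A q v := fun q => rfl
  have : Module.Finite F (F[X] ⧸ Ideal.span {p}) := hp.finite_quotient
  have hsurj : Function.Surjective ψ := fun x => by
    obtain ⟨q, hq⟩ := hA.exists_aeval x
    exact ⟨Ideal.Quotient.mk _ q, hq⟩
  have hfin : finrank F (F[X] ⧸ Ideal.span {p}) = finrank F V := by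
    rw [finrank_quotient_span_eq_natDegree, hV]
  exact ⟨LinearEquiv.ofBijective ψ
    ⟨(LinearMap.injective_iff_surjective_of_finrank_eq_finrank hfin).2 hsurj, hsurj⟩, hψ⟩

/-- Two endomorphisms with cyclic vectors annihilated by the same polynomial, of degree the
dimension, are similar. -/
lemma exists_equiv_of_isCyclicVector [FiniteDimensional F V] [FiniteDimensional F W]
    {A : End F V} {B : End F W} {v : V} {w : W} (hA : IsCyclicVector A v)
    (hB : IsCyclicVector B w) {p : F[X]} (hp : p.Monic) (hV : finrank F V = p.natDegree)
    (hW : finrank F W = p.natDegree) (hpA : aeval A p v = 0) (hpB : aeval B p w = 0) :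
    ∃ e : V ≃ₗ[F] W, e v = w ∧ ∀ x, e (A x) = B (e x) := by
  obtain ⟨e, he⟩ := exists_quotient_equiv_of_isCyclicVector hA hp hV hpA
  obtain ⟨f, hf⟩ := exists_quotient_equiv_of_isCyclicVector hB hp hW hpB
  refine ⟨e.symm.trans f, ?_, fun x => ?_⟩
  · have h : e 1 = v := by simpa using he 1
    have h' : f 1 = w := by simpa using hf 1
    simp [← h, h']
  · obtain ⟨q, rfl⟩ := hA.exists_aeval x
    have h : A (aeval A q v) = e (Ideal.Quotient.mk _ (X * q)) := by rw [he]; simp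
    rw [h, ← he]
    simp only [LinearEquiv.trans_apply, LinearEquiv.symm_apply_apply, hf]
    simp

lemma IsCyclicVector.smul {A : End F V} {v : V} (hA : IsCyclicVector A v) {c : F} (hc : c ≠ 0) :
    IsCyclicVector (c • A) v := by
  intro U hv hU
  refine hA U hv fun x hx => ?_
  exact (U.smul_mem_iff hc).1 (hU x hx)

lemma mem_of_apply_mem [FiniteDimensional F V] {A : End F V} (hA : Function.Injective A)
    {U : Submodule F V} (hU : ∀ x ∈ U, A x ∈ U) {x : V} (hx : A x ∈ U) : x ∈ U := by
  have hs : Function.Surjective (A.restrict hU) :=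
    LinearMap.injective_iff_surjective.1 fun a b hab => Subtype.ext (hA (congrArg Subtype.val hab))
  obtain ⟨y, hy⟩ := hs ⟨A x, hx⟩
  have : A y = A x := congrArg Subtype.val hy
  exact hA this ▸ y.2

lemma IsCyclicVector.of_apply [FiniteDimensional F V] {A : End F V} (hA : Function.Injective A)
    {v : V} (hv : IsCyclicVector A v) : IsCyclicVector A (A v) :=
  fun U hU hAU => hv U (mem_of_apply_mem hA hAU hU) hAU

lemma IsCyclicVector.inverse [FiniteDimensional F V] {A B : End F V} (hAB : A * B = 1)
    {v : V} (hv : IsCyclicVector A v) : IsCyclicVector B v := by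
  have hBA : B * A = 1 := mul_eq_one_comm.1 hAB
  refine fun U hU hBU => hv U hU fun x hx => ?_
  have hB : Function.Injective B := Function.LeftInverse.injective (g := A) fun x => by
    simpa using LinearMap.congr_fun hAB x
  exact mem_of_apply_mem hB hBU (by simpa using (LinearMap.congr_fun hBA x).symm ▸ hx)

/-- Pole placement: a rank one perturbation along a cyclic vector realizes any characteristic
polynomial. -/
lemma exists_pole_placement [FiniteDimensional F V] {A : End F V} {v : V}
    (hA : IsCyclicVector A v) {p₀ p : F[X]} (hp₀ : p₀.Monic) (hp : p.Monic)
    (hd₀ : p₀.natDegree = finrank F V) (hd : p.natDegree = finrank F V)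
    (h₀ : aeval A p₀ v = 0) :
    ∃ φ : V →ₗ[F] F, IsCyclicVector (A + φ.smulRight v) v ∧ aeval (A + φ.smulRight v) p v = 0 ∧
      φ (aeval A p₀.divX v) = p₀.coeff 0 - p.coeff 0 := by
  set n := finrank F V with hn
  let h : ℕ → V := fun k => aeval A (divX^[k + 1] p₀) v
  have hstep : ∀ (B : End F V) (q : F[X]) (k : ℕ), aeval B (divX^[k] q) v =
      B (aeval B (divX^[k + 1] q) v) + q.coeff k • v := by
    intro B q k
    have hc : ∀ (k : ℕ) (q : F[X]), (divX^[k] q).coeff 0 = q.coeff k := by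
      intro k
      induction k with
      | zero => simp
      | succ k ih => intro q; rw [Function.iterate_succ_apply, ih, coeff_divX]
    conv_lhs => rw [← X_mul_divX_add (divX^[k] q)]
    rw [hc, ← Function.iterate_succ_apply' divX]
    simp
  have htop : ∀ q : F[X], q.Monic → q.natDegree = n → divX^[n] q = 1 := by
    intro q hq hqn
    rw [← hqn]
    clear hqn
    induction hm : q.natDegree generalizing q with
    | zero => simpa using hq.natDegree_eq_zero.1 hm
    | succ m ih =>
      have h1 : q.divX.natDegree = m := by
        rw [natDegree_divX_eq_natDegree_tsub_one, hm]; rfl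
      rw [Function.iterate_succ_apply]
      refine ih _ ?_ h1
      rw [Monic, leadingCoeff, h1, coeff_divX, ← hm]
      exact hq
  have hlast : ∀ k, k + 1 = n → h k = v := by
    intro k hk
    change aeval A (divX^[k + 1] p₀) v = v
    rw [hk, htop p₀ hp₀ hd₀]
    simp
  rcases Nat.eq_zero_or_pos n with hn0 | hpos
  · have : Subsingleton V := finrank_zero_iff.1 (hn ▸ hn0)
    have h1 := hp₀.natDegree_eq_zero.1 (hd₀.trans hn0)
    have h2 := hp.natDegree_eq_zero.1 (hd.trans hn0)
    exact ⟨0, fun U _ _ => Subsingleton.elim _ _, Subsingleton.elim _ _, by simp [h1, h2]⟩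
  have hspan : (⊤ : Submodule F V) ≤ Submodule.span F (Set.range fun i : Fin n => h i) := by
    have hmem : ∀ k < n, h k ∈ Submodule.span F (Set.range fun i : Fin n => h i) :=
      fun k hk => Submodule.subset_span ⟨⟨k, hk⟩, rfl⟩
    have hv : v ∈ Submodule.span F (Set.range fun i : Fin n => h i) := by
      rw [← hlast (n - 1) (by omega)]
      exact hmem _ (by omega)
    refine (hA _ hv fun x hx => ?_).ge
    induction hx using Submodule.span_induction with
    | zero => simp
    | add x y _ _ hx hy => rw [map_add]; exact Submodule.add_mem _ hx hy
    | smul c x _ hx => rw [map_smul]; exact Submodule.smul_mem _ c hx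
    | mem x hx =>
      obtain ⟨⟨k, hk⟩, rfl⟩ := hx
      have hs := hstep A p₀ k
      cases k with
      | zero =>
        have : A (h 0) = -(p₀.coeff 0 • v) := eq_neg_of_add_eq_zero_left (hs.symm.trans h₀)
        exact this ▸ Submodule.neg_mem _ (Submodule.smul_mem _ _ hv)
      | succ k =>
        have : A (h (k + 1)) = h k - p₀.coeff (k + 1) • v := eq_sub_of_add_eq hs.symm
        exact this ▸ Submodule.sub_mem _ (hmem k (by omega)) (Submodule.smul_mem _ _ hv)
  let b := basisOfTopLeSpanOfCardEqFinrank (fun i : Fin n => h i) hspan (by simp [hn])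
  let φ : V →ₗ[F] F := b.constr F fun i : Fin n => p₀.coeff i - p.coeff i
  have hφ : ∀ k < n, φ (h k) = p₀.coeff k - p.coeff k := by
    intro k hk
    have : b ⟨k, hk⟩ = h k := by simp [b]
    rw [← this]
    simp [φ]
  set B : End F V := A + φ.smulRight v with hB
  have hBapp : ∀ x, B x = A x + φ x • v := fun x => by simp [hB]
  have hBh : ∀ j k, k + j + 1 = n → aeval B (divX^[k + 1] p) v = h k := by
    intro j
    induction j with
    | zero =>
      intro k hk
      rw [hlast k (by omega), show k + 1 = n by omega, htop p hp hd]
      simp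
    | succ j ih =>
      intro k hk
      rw [hstep, ih (k + 1) (by omega), hBapp, hφ (k + 1) (by omega)]
      refine Eq.trans ?_ (hstep A p₀ (k + 1)).symm
      change _ = A (h (k + 1)) + _
      module
  refine ⟨φ, fun U hv hU => ?_, ?_, hφ 0 hpos⟩
  · refine top_le_iff.1 (hspan.trans (Submodule.span_le.2 ?_))
    rintro _ ⟨⟨k, hk⟩, rfl⟩
    have hm := aeval_mem_of_invariant hU hv (divX^[k + 1] p)
    rwa [hBh (n - 1 - k) k (by omega)] at hm
  · have h1 := hstep B p 0
    rw [hBh (n - 1) 0 (by omega), hBapp, hφ 0 hpos] at h1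
    have h2 : A (h 0) + p₀.coeff 0 • v = 0 := (hstep A p₀ 0).symm.trans h₀
    refine h1.trans (Eq.trans ?_ h2)
    module

end Cyclic

section Unipotent

universe v

variable {F V W : Type*} [Field F] [AddCommGroup V] [Module F V] [AddCommGroup W] [Module F W]

lemma det_eq_one_of_isNilpotent_sub_one [FiniteDimensional F V] {L : End F V}
    (hL : IsNilpotent (L - 1)) : LinearMap.det L = 1 := by
  have h : IsNilpotent (1 - L) := by rw [← neg_sub]; exact hL.neg
  have := LinearMap.eval_charpoly (1 - L) 1
  rw [IsNilpotent.charpoly_eq_X_pow_finrank h] at this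
  simpa using this.symm

lemma IsFactor.det [FiniteDimensional F V] {b : Bool} {L : End F V} (h : IsFactor b L) :
    LinearMap.det L = 1 ∨ LinearMap.det L = -1 := by
  cases b
  · exact .inl (det_eq_one_of_isNilpotent_sub_one ⟨2, by rw [pow_two]; exact h⟩)
  · exact mul_self_eq_one_iff.1 (by rw [← map_mul, h, map_one])

/-- The endomorphism of `F × V` with block matrix `[[a, r], [u, D]]`. -/
def blockEnd (a : F) (r : V →ₗ[F] F) (u : V) (D : End F V) : End F (F × V) where
  toFun x := (a * x.1 + r x.2, x.1 • u + D x.2)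
  map_add' x y := by ext <;> simp [mul_add, add_smul] <;> abel
  map_smul' c x := by ext <;> simp [mul_smul, mul_add, mul_left_comm]

@[simp]
lemma blockEnd_apply (a : F) (r : V →ₗ[F] F) (u : V) (D : End F V) (x : F × V) :
    blockEnd a r u D x = (a * x.1 + r x.2, x.1 • u + D x.2) := rfl

lemma exists_eq_blockEnd (M : End F (F × V)) : ∃ a r u D, M = blockEnd a r u D := by
  refine ⟨(M (1, 0)).1, LinearMap.fst F F V ∘ₗ M ∘ₗ LinearMap.inr F F V, (M (1, 0)).2,
    LinearMap.snd F F V ∘ₗ M ∘ₗ LinearMap.inr F F V, LinearMap.ext fun x => ?_⟩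
  have hx : x = x.1 • (1, 0) + (0, x.2) := by ext <;> simp
  conv_lhs => rw [hx, map_add, map_smul]
  ext <;> simp [mul_comm]

lemma blockEnd_mul (a a' : F) (r r' : V →ₗ[F] F) (u u' : V) (D D' : End F V) :
    blockEnd a r u D * blockEnd a' r' u' D' =
      blockEnd (a * a' + r u') (a • r' + r ∘ₗ D') (a' • u + D u') (r'.smulRight u + D * D') := by
  refine LinearMap.ext fun x => ?_
  ext
  · simp; ring
  · simp; module

lemma IsCyclicVector.blockEnd {D : End F V} {u : V} (h : IsCyclicVector D u) (a : F)
    (r : V →ₗ[F] F) : IsCyclicVector (blockEnd a r u D) ((1, 0) : F × V) := by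
  intro U h1 hU
  have hin : ∀ c : F, ((c, 0) : F × V) ∈ U := fun c => by simpa using U.smul_mem c h1
  have hs : ∀ x ∈ U, ((0, x.2) : F × V) ∈ U := fun x hx => by
    have : ((0, x.2) : F × V) = x - (x.1, 0) := by ext <;> simp
    exact this ▸ U.sub_mem hx (hin x.1)
  have htop : U.comap (LinearMap.inr F F V) = ⊤ := by
    apply h
    · simpa using hs _ (hU _ h1)
    · intro x hx
      simpa using hs _ (hU _ hx)
  refine eq_top_iff.2 fun x _ => ?_
  have hx : x.2 ∈ U.comap (LinearMap.inr F F V) := htop ▸ Submodule.mem_top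
  simpa using U.add_mem (hin x.1) hx

lemma isNilpotent_blockEnd_upper {L : End F V} (hL : IsNilpotent (L - 1)) (t : V →ₗ[F] F) :
    IsNilpotent (blockEnd 1 t 0 L - 1) := by
  obtain ⟨k, hk⟩ := hL
  have h : ∀ j x, (((blockEnd 1 t 0 L - 1) ^ j : End F (F × V)) x).2 = ((L - 1) ^ j) x.2 := by
    intro j
    induction j with
    | zero => simp
    | succ j ih => intro x; rw [pow_succ, pow_succ]; simp [ih]
  refine ⟨k + 1, LinearMap.ext fun x => ?_⟩
  have hx := h k x
  rw [hk] at hx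
  rw [pow_succ', Module.End.mul_apply]
  ext <;> simp [hx]

lemma isNilpotent_blockEnd_lower {L : End F V} (hL : IsNilpotent (L - 1)) (z : V) :
    IsNilpotent (blockEnd 1 0 z L - 1) := by
  obtain ⟨k, hk⟩ := hL
  have h : ∀ j y, ((blockEnd 1 0 z L - 1) ^ j : End F (F × V)) (0, y) = (0, ((L - 1) ^ j) y) := by
    intro j
    induction j with
    | zero => simp
    | succ j ih => intro x; rw [pow_succ, pow_succ]; simp [ih]
  refine ⟨k + 1, LinearMap.ext fun x => ?_⟩
  rw [pow_succ, Module.End.mul_apply]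
  have : (blockEnd 1 0 z L - 1) x = (0, x.1 • z + L x.2 - x.2) := by ext <;> simp
  rw [this, h, hk]
  rfl

/-- Any vector not killed by `φ` splits off. -/
lemma exists_equiv_prod_ker {φ : V →ₗ[F] F} {e : V} (he : φ e = 1) :
    ∃ E : V ≃ₗ[F] F × LinearMap.ker φ, E e = (1, 0) ∧ ∀ x, (E x).1 = φ x := by
  let π : V →ₗ[F] LinearMap.ker φ :=
    LinearMap.codRestrict (LinearMap.ker φ) (LinearMap.id - φ.smulRight e)
      (fun x => by simp [he])
  have hπ : ∀ x, (π x : V) = x - φ x • e := fun x => rfl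
  refine ⟨LinearEquiv.ofLinearMap (φ.prod π)
    ((LinearMap.toSpanSingleton F V e).coprod (LinearMap.ker φ).subtype) ?_ ?_, ?_, ?_⟩
  · refine LinearMap.ext fun x => Prod.ext ?_ (Subtype.ext ?_)
    · simp [he]
    · simp [hπ, he]
  · ext x; simp [hπ]
  · refine Prod.ext ?_ (Subtype.ext ?_)
    · simp [he]
    · simp [hπ, he]
  · simp

lemma IsCyclicVector.equiv {A : End F V} {v : V} (h : IsCyclicVector A v) (E : V ≃ₗ[F] W) :
    IsCyclicVector (E.conjRingEquiv A) (E v) := by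
  intro U hv hU
  have := h (U.comap E.toLinearMap) hv fun x hx => by simpa using hU _ hx
  refine eq_top_iff.2 fun x _ => ?_
  have hx : E.symm x ∈ U.comap E.toLinearMap := this ▸ Submodule.mem_top
  simpa using hx

lemma exists_unipotent_blockEnd_of_ne_zero {r : V →ₗ[F] F} {u : V} {D : End F V}
    (hM : Function.Injective (blockEnd 1 r u D))
    (ih : ∀ X : End F V, Function.Injective X →
      ∃ L : End F V, IsNilpotent (L - 1) ∧ IsCyclicVector (X * L) u) :
    ∃ L : End F (F × V), IsNilpotent (L - 1) ∧ L (1, 0) = (1, 0) ∧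
      IsCyclicVector (blockEnd 1 r u D * L) (1, 0) := by
  have hX : Function.Injective (D - r.smulRight u : End F V) := by
    refine (injective_iff_map_eq_zero _).2 fun h hh => ?_
    have hD : D h = r h • u := by simpa [sub_eq_zero] using hh
    have := @hM (-r h, h) 0 (by ext <;> simp [hD])
    simpa using congrArg Prod.snd this
  obtain ⟨L, hL, hc⟩ := ih _ hX
  refine ⟨blockEnd 1 (-(r ∘ₗ L)) 0 L, isNilpotent_blockEnd_upper hL _, by ext <;> simp, ?_⟩
  have hD : (-(r ∘ₗ L)).smulRight u + D * L = (D - r.smulRight u) * L := by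
    ext x; simp [sub_eq_add_neg, add_comm]
  have hu : (1 : F) • u + D 0 = u := by simp
  rw [blockEnd_mul, hD, hu]
  exact hc.blockEnd _ _

lemma exists_unipotent_blockEnd_zero {μ : F} {r : V →ₗ[F] F} {D : End F V} [FiniteDimensional F V]
    (hM : Function.Injective (blockEnd μ r 0 D)) {h : V}
    (ih : ∀ X : End F V, Function.Injective X →
      ∃ L : End F V, IsNilpotent (L - 1) ∧ IsCyclicVector (X * L) h) :
    ∃ L : End F (F × V), IsNilpotent (L - 1) ∧ IsCyclicVector (blockEnd μ r 0 D * L) (1, 0) := by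
  have hμ : μ ≠ 0 := by
    rintro rfl
    simpa using @hM (1, 0) 0 (by ext <;> simp)
  have hD : Function.Injective D := by
    refine (injective_iff_map_eq_zero _).2 fun h hh => ?_
    have := @hM (-(μ⁻¹ * r h), h) 0 (by ext <;> simp [hh, hμ])
    simpa using congrArg Prod.snd this
  obtain ⟨z, rfl⟩ := LinearMap.injective_iff_surjective.1 hD h
  obtain ⟨L, hL, hc⟩ := ih _ hD
  refine ⟨blockEnd 1 0 z L, isNilpotent_blockEnd_lower hL _, ?_⟩
  have hz : (1 : F) • (0 : V) + D z = D z := by simp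
  rw [blockEnd_mul, hz, LinearMap.smulRight_zero, zero_add]
  exact hc.blockEnd _ _

lemma exists_unipotent_of_equiv (E : V ≃ₗ[F] W) {M : End F V} {e : V} {L' : End F W}
    (hL : IsNilpotent (L' - 1)) (hc : IsCyclicVector (E.conjRingEquiv M * L') (E e)) :
    ∃ L : End F V, IsNilpotent (L - 1) ∧ (∀ x, L x = E.symm (L' (E x))) ∧
      IsCyclicVector (M * L) e := by
  refine ⟨E.symm.conjRingEquiv L', ?_, fun x => by simp, ?_⟩
  · simpa using hL.map E.symm.conjRingEquiv
  · have h := hc.equiv E.symm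
    rw [map_mul, E.symm_apply_apply] at h
    convert h using 2
    ext; simp

lemma exists_unipotent_isCyclicVector_of_finrank_lt {V : Type v} [AddCommGroup V] [Module F V]
    [FiniteDimensional F V] {M : End F V}
    (hM : Function.Injective M) {e : V} (he : M e ∉ F ∙ e)
    (ih : ∀ (H : Type v) [AddCommGroup H] [Module F H] [FiniteDimensional F H],
      finrank F H < finrank F V → ∀ u : H, u ≠ 0 → ∀ X : End F H, Function.Injective X →
        ∃ L : End F H, IsNilpotent (L - 1) ∧ IsCyclicVector (X * L) u) :
    ∃ L : End F V, IsNilpotent (L - 1) ∧ L e = e ∧ IsCyclicVector (M * L) e := by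
  have he' : e ∉ F ∙ (M e - e) := by
    intro h
    obtain ⟨c, hc⟩ := Submodule.mem_span_singleton.1 h
    rcases eq_or_ne c 0 with rfl | hc0
    · rw [zero_smul] at hc
      simp [← hc] at he
    · refine he (Submodule.mem_span_singleton.2 ⟨1 + c⁻¹, ?_⟩)
      have := congrArg (c⁻¹ • ·) hc
      simp only [smul_smul, inv_mul_cancel₀ hc0, one_smul] at this
      rw [add_smul, ← this]
      simp
  obtain ⟨φ, hφ, hφ'⟩ := LinearMap.exists_extend_of_notMem (0 : (F ∙ (M e - e)) →ₗ[F] F) he' 1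
  have hφM : φ (M e) = 1 := by
    have := LinearMap.congr_fun hφ ⟨M e - e, Submodule.mem_span_singleton_self _⟩
    simpa [hφ', sub_eq_zero] using this
  obtain ⟨E, hE, hE'⟩ := exists_equiv_prod_ker hφ'
  obtain ⟨a, r, u, D, hB⟩ := exists_eq_blockEnd (E.conjRingEquiv M)
  have hBe : E (M e) = (a, u) := by
    simpa using! (LinearMap.congr_fun hB (E e)).trans (by simp [hE])
  obtain rfl : a = 1 := by rw [← hφM, ← hE', hBe]
  have hu : u ≠ 0 := by
    rintro rfl
    have h1 : M e = e := E.injective (hBe.trans hE.symm)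
    rw [h1] at he
    exact he (Submodule.mem_span_singleton_self _)
  have hinj : Function.Injective (blockEnd 1 r u D) := by
    rw [← hB]
    exact E.injective.comp (hM.comp E.symm.injective)
  obtain ⟨L', hL, hLe, hc⟩ := exists_unipotent_blockEnd_of_ne_zero hinj
    (ih _ (by rw [E.finrank_eq, finrank_prod, finrank_self]; omega) u hu)
  obtain ⟨L, hL1, hL2, hL3⟩ := exists_unipotent_of_equiv E (e := e) hL (by rwa [hB, hE])
  exact ⟨L, hL1, by rw [hL2, hE, hLe, ← hE, E.symm_apply_apply], hL3⟩

/-- Every nonzero vector is cyclic for some unipotent modification of an automorphism. -/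
lemma exists_unipotent_isCyclicVector [FiniteDimensional F V] {M : End F V}
    (hM : Function.Injective M) {e : V} (he : e ≠ 0) :
    ∃ L : End F V, IsNilpotent (L - 1) ∧ IsCyclicVector (M * L) e := by
  induction hn : finrank F V using Nat.strong_induction_on generalizing V with
  | _ n ih =>
  subst hn
  by_cases hMe : M e ∈ F ∙ e
  · obtain ⟨μ, hμ⟩ := Submodule.mem_span_singleton.1 hMe
    obtain ⟨φ, -, hφ⟩ := LinearMap.exists_extend_of_notMem (0 : (⊥ : Submodule F V) →ₗ[F] F)
      (v := e) (by simpa using he) 1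
    obtain ⟨E, hE, -⟩ := exists_equiv_prod_ker hφ
    obtain ⟨a, r, u, D, hB⟩ := exists_eq_blockEnd (E.conjRingEquiv M)
    have hBe : E (M e) = (a, u) := by
      simpa using! (LinearMap.congr_fun hB (E e)).trans (by simp [hE])
    obtain rfl : u = 0 := by
      rw [← hμ, map_smul, hE] at hBe
      simpa using (congrArg Prod.snd hBe).symm
    have hinj : Function.Injective (blockEnd a r 0 D) := by
      rw [← hB]
      exact E.injective.comp (hM.comp E.symm.injective)
    obtain ⟨h, ih'⟩ : ∃ h : LinearMap.ker φ, ∀ X : End F (LinearMap.ker φ),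
        Function.Injective X → ∃ L : End F (LinearMap.ker φ),
          IsNilpotent (L - 1) ∧ IsCyclicVector (X * L) h := by
      rcases subsingleton_or_nontrivial (LinearMap.ker φ) with hs | hs
      · exact ⟨0, fun X _ => ⟨1, by simp, fun U _ _ => Subsingleton.elim _ _⟩⟩
      · obtain ⟨h, hh⟩ := exists_ne (0 : LinearMap.ker φ)
        exact ⟨h, fun X hX => ih _
          (by rw [E.finrank_eq, finrank_prod, finrank_self]; omega) hX hh rfl⟩
    obtain ⟨L', hL, hc⟩ := exists_unipotent_blockEnd_zero hinj ih'
    obtain ⟨L, hL1, -, hL3⟩ := exists_unipotent_of_equiv E (e := e) hL (by rwa [hB, hE])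
    exact ⟨L, hL1, hL3⟩
  · obtain ⟨L, hL, -, hc⟩ := exists_unipotent_isCyclicVector_of_finrank_lt hM hMe
      fun H _ _ _ hH u hu X hX => ih _ hH hX hu rfl
    exact ⟨L, hL, hc⟩

lemma exists_unipotent_isCyclicVector_of_notMem [FiniteDimensional F V] {M : End F V}
    (hM : Function.Injective M) {e : V} (he : M e ∉ F ∙ e) :
    ∃ L : End F V, IsNilpotent (L - 1) ∧ L e = e ∧ IsCyclicVector (M * L) e :=
  exists_unipotent_isCyclicVector_of_finrank_lt hM he
    fun _ _ _ _ _ _ hu _ hX => exists_unipotent_isCyclicVector hX hu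

/-- A nonscalar automorphism multiplied by a suitable unipotent one becomes cyclic with any
characteristic polynomial that is compatible with the determinant. -/
lemma exists_unipotent_aeval_eq_zero [FiniteDimensional F V] {M : End F V}
    (hM : Function.Injective M) {e : V} (he : M e ∉ F ∙ e) {p : F[X]} (hp : p.Monic)
    (hd : p.natDegree = finrank F V) (hp0 : p.coeff 0 = (-1) ^ finrank F V * LinearMap.det M) :
    ∃ L : End F V, IsNilpotent (L - 1) ∧
      ∃ w, IsCyclicVector (M * L) w ∧ aeval (M * L) p w = 0 := by
  obtain ⟨L, hL, hLe, hc⟩ := exists_unipotent_isCyclicVector_of_notMem hM he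
  set A := M * L with hA
  have hdetM : LinearMap.det M ≠ 0 := by
    have := (LinearMap.isUnit_iff_ker_eq_bot M).2 (LinearMap.ker_eq_bot.2 hM)
    exact (this.map LinearMap.det).ne_zero
  have hdet : LinearMap.det A = LinearMap.det M := by
    rw [hA, map_mul, det_eq_one_of_isNilpotent_sub_one hL, mul_one]
  have hAinj : Function.Injective A := by
    refine LinearMap.ker_eq_bot.1 ((LinearMap.isUnit_iff_ker_eq_bot A).1 ?_)
    exact (LinearMap.isUnit_iff_isUnit_det A).2 (hdet ▸ hdetM.isUnit)
  have hc0 : A.charpoly.coeff 0 = (-1) ^ finrank F V * LinearMap.det M := by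
    rw [← hdet, LinearMap.det_eq_sign_charpoly_coeff, ← mul_assoc, ← mul_pow]
    simp
  obtain ⟨φ, h1, h2, h3⟩ := exists_pole_placement (hc.of_apply hAinj) A.charpoly_monic hp
    A.charpoly_natDegree hd (by simp [LinearMap.aeval_self_charpoly])
  rw [hc0, hp0, sub_self] at h3
  have h4 : aeval A A.charpoly.divX (A e) = -A.charpoly.coeff 0 • e := by
    have := LinearMap.congr_fun A.aeval_self_charpoly e
    rw [← divX_mul_X_add A.charpoly] at this
    rw [neg_smul]
    refine eq_neg_of_add_eq_zero_left ?_
    simpa using this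
  have hφe : φ e = 0 := by
    rw [h4, hc0] at h3
    simpa [hdetM] using h3
  have hM' : M * (L + φ.smulRight e) = A + φ.smulRight (A e) := by
    ext x
    simp [hA, hLe]
  refine ⟨L + φ.smulRight e, ?_, A e, hM' ▸ h1, hM' ▸ h2⟩
  have hB : (L + φ.smulRight e - 1) * (L + φ.smulRight e - 1) =
      (L + φ.smulRight e - 1) * (L - 1) := by
    ext x
    simp only [LinearMap.sub_apply, LinearMap.add_apply, Module.End.mul_apply, Module.End.one_apply,
      LinearMap.smulRight_apply, map_sub, map_add, map_smul, hLe, hφe]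
    module
  have hN : ∀ k, (L + φ.smulRight e - 1) ^ (k + 1) = (L + φ.smulRight e - 1) * (L - 1) ^ k := by
    intro k
    induction k with
    | zero => simp
    | succ k ih =>
      rw [pow_succ', ih, ← mul_assoc, hB, mul_assoc, pow_succ']
  obtain ⟨k, hk⟩ := hL
  exact ⟨k + 1, by rw [hN, hk, mul_zero]⟩

end Unipotent

section Model

universe u

variable {F : Type u} [Field F]

/-- The polynomial `p` is the characteristic polynomial of some `P * Q` having a cyclic vector
fixed by `Q`, where `P` and `Q` are of types `a` and `b`. -/
def HasFixedModel (a b : Bool) (p : F[X]) : Prop :=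
  ∃ (V : Type u) (_ : AddCommGroup V) (_ : Module F V) (_ : FiniteDimensional F V)
    (P Q : End F V) (e : V), finrank F V = p.natDegree ∧ IsFactor a P ∧ IsFactor b Q ∧
      Q e = e ∧ IsCyclicVector (P * Q) e ∧ aeval (P * Q) p e = 0

/-- The polynomial `p` is the characteristic polynomial of some `P * Q` having a cyclic vector,
where `P` and `Q` are of types `a` and `b`. -/
def HasModel (a b : Bool) (p : F[X]) : Prop :=
  ∃ (V : Type u) (_ : AddCommGroup V) (_ : Module F V) (_ : FiniteDimensional F V)
    (A : End F V) (e : V), finrank F V = p.natDegree ∧ HasFactorization [a, b] A ∧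
      IsCyclicVector A e ∧ aeval A p e = 0

/-- The generic determinant of a `2 × 2` block of an involution (`-1`) or a U2-matrix (`1`). -/
def blockSign (F : Type*) [Field F] : Bool → F
  | true => -1
  | false => 1

lemma isFactor_blockSign (b : Bool) : IsFactor b (blockSign F b) := by
  cases b <;> simp [IsFactor, blockSign]

lemma blockSign_mul_self (b : Bool) : blockSign F b * blockSign F b = 1 := by
  cases b <;> simp [blockSign]

lemma HasFixedModel.hasModel {a b : Bool} {p : F[X]} (h : HasFixedModel a b p) :
    HasModel a b p := by
  obtain ⟨V, _, _, _, P, Q, e, hd, hP, hQ, -, hc, hp⟩ := h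
  exact ⟨V, _, _, ‹_›, P * Q, e, hd, hasFactorization_pair.2 ⟨P, Q, hP, hQ, rfl⟩, hc, hp⟩

lemma aeval_mul_X_apply {V : Type*} [AddCommGroup V] [Module F V] (A : End F V) (p : F[X])
    (v : V) : aeval A (p * X) v = aeval A p (A v) := by
  simp

lemma aeval_apply_of_intertwine {V W : Type*} [AddCommGroup V] [Module F V] [AddCommGroup W]
    [Module F W] {A : End F V} {B : End F W} (f : V →ₗ[F] W) (h : ∀ x, f (A x) = B (f x))
    (p : F[X]) (v : V) : aeval B p (f v) = f (aeval A p v) := by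
  induction p using Polynomial.induction_on generalizing v with
  | C a => simp
  | add p q hp hq => simp [hp, hq]
  | monomial n a ih =>
    rw [pow_succ, ← mul_assoc, aeval_mul_X_apply, aeval_mul_X_apply, ← h, ih]

lemma IsFactor.injective {V : Type*} [AddCommGroup V] [Module F V] {b : Bool} {P : End F V}
    (h : IsFactor b P) : Function.Injective P := by
  obtain ⟨Q, -, -, hQ⟩ := h.exists_inverse
  exact Function.LeftInverse.injective (g := Q) fun x => LinearMap.congr_fun hQ x

lemma hasFixedModel_one (a b : Bool) : HasFixedModel a b (1 : F[X]) :=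
  ⟨PUnit, _, _, inferInstance, 1, 1, 0, by simp [finrank_zero_of_subsingleton], isFactor_one a,
    isFactor_one b, rfl, fun _ _ _ => Subsingleton.elim _ _, Subsingleton.elim _ _⟩

lemma hasFixedModel_X_sub_C {a : Bool} (b : Bool) {ε : F} (hε : IsFactor a ε) :
    HasFixedModel a b (X - C ε) := by
  refine ⟨F, _, _, inferInstance, algebraMap F (End F F) ε, 1, 1, by simp, hε.map _,
    isFactor_one b, rfl, fun U h1 _ => ?_, by simp⟩
  refine eq_top_iff.2 fun x _ => ?_
  simpa using U.smul_mem x h1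

lemma isFactor_blockEnd_lower {V : Type*} [AddCommGroup V] [Module F V] {b : Bool} {t : F}
    {w : V} {D : End F V} (ht : IsFactor b t) (hD : IsFactor b D)
    (hw : D w = (blockSign F b * t) • w) : IsFactor b (blockEnd t 0 w D) := by
  cases b
  · obtain rfl : t = 1 := by simpa [IsFactor, sub_eq_zero] using ht
    have h : ∀ v, (D - 1) ((D - 1) v) = 0 := fun v => LinearMap.congr_fun hD v
    refine LinearMap.ext fun x => ?_
    simp [blockSign] at h hw
    ext
    · simp
    · simp [hw]
      rw [← h x.2]
      abel
  · have h : ∀ v, D (D v) = v := fun v => LinearMap.congr_fun hD v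
    have ht' : t * t = 1 := ht
    refine LinearMap.ext fun x => ?_
    simp [blockSign] at hw
    ext
    · simp [← mul_assoc, ht']
    · simp [hw, h]
      module

lemma isFactor_blockEnd_upper {V : Type*} [AddCommGroup V] [Module F V] {b : Bool} {t : F}
    {r : V →ₗ[F] F} {D : End F V} (ht : IsFactor b t) (hD : IsFactor b D)
    (hr : ∀ x, r (D x) = blockSign F b * t * r x) : IsFactor b (blockEnd t r 0 D) := by
  cases b
  · obtain rfl : t = 1 := by simpa [IsFactor, sub_eq_zero] using ht
    have h : ∀ v, (D - 1) ((D - 1) v) = 0 := fun v => LinearMap.congr_fun hD v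
    refine LinearMap.ext fun x => ?_
    simp [blockSign] at h hr
    ext
    · simp [hr]
    · simp [h]
  · have h : ∀ v, D (D v) = v := fun v => LinearMap.congr_fun hD v
    have ht' : t * t = 1 := ht
    refine LinearMap.ext fun x => ?_
    simp [blockSign] at hr
    ext
    · simp [← mul_assoc, ht', hr, mul_add]
    · simp [h]

lemma monic_X_sq_sub (τ c : F) : (X ^ 2 - C τ * X + C c).Monic := by
  monicity!

lemma natDegree_X_sq_sub (τ c : F) : (X ^ 2 - C τ * X + C c).natDegree = 2 := by
  compute_degree!

lemma HasFixedModel.pair {a b : Bool} {p : F[X]} (hp : p.Monic) (h : HasFixedModel a b p)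
    (τ : F) :
    HasFixedModel a b (p * (X ^ 2 - C τ * X + C (blockSign F a * blockSign F b))) := by
  obtain ⟨V, _, _, _, P, Q, e, hd, hP, hQ, hQe, hc, hpe⟩ := h
  set π := blockSign F a with hπ
  set κ := blockSign F b with hκ
  set α := τ - 1 - π * κ with hα
  let P' : End F (F × F × V) := blockEnd 1 0 (1, 0) (blockEnd π 0 0 P)
  let Q' : End F (F × F × V) := blockEnd 1 (α • LinearMap.fst F F V) 0 (blockEnd κ 0 e Q)
  have hP' : IsFactor a P' :=
    isFactor_blockEnd_lower (isFactor_one a) (isFactor_blockEnd_lower (isFactor_blockSign a) hP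
      (by simp)) (by simp [hπ])
  have hQ' : IsFactor b Q' :=
    isFactor_blockEnd_upper (isFactor_one b) (isFactor_blockEnd_lower (isFactor_blockSign b) hQ
      (by rw [blockSign_mul_self, one_smul, hQe])) (fun x => by simp [hκ, mul_left_comm])
  let ι : V →ₗ[F] F × F × V := LinearMap.inr F F (F × V) ∘ₗ LinearMap.inr F F V
  have hι : ∀ v, ι ((P * Q) v) = (P' * Q') (ι v) := fun v => by simp [ι, P', Q']
  have hA1 : (P' * Q') (1, 0) = (1, 1, 0) := by simp [P', Q']
  have hA2 : (P' * Q') (1, 1, 0) = τ • (1, 1, 0) - (π * κ) • (1, 0) + (P' * Q') (ι e) := by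
    ext <;> simp [P', Q', ι, hQe, hα] <;> ring
  have hinj : Function.Injective (P' * Q') := hP'.injective.comp hQ'.injective
  refine ⟨F × F × V, _, _, inferInstance, P', Q', (1, 0), ?_, hP', hQ', by simp [Q'],
    fun U h1 hU => ?_, ?_⟩
  · rw [hp.natDegree_mul (monic_X_sq_sub _ _), natDegree_X_sq_sub, finrank_prod, finrank_prod,
      finrank_self, hd]
    ring
  · have h11 : (1, 1, 0) ∈ U := hA1 ▸ hU _ h1
    have h12 : (P' * Q') (ι e) ∈ U := by
      have := hU _ h11
      rw [hA2] at this
      refine (U.add_mem_iff_right (U.sub_mem (U.smul_mem _ h11) (U.smul_mem _ h1))).1 this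
    have htop : U.comap ι = ⊤ := hc _ (mem_of_apply_mem hinj hU h12) fun x hx => by
      simpa only [Submodule.mem_comap, hι] using hU _ hx
    refine eq_top_iff.2 fun x _ => ?_
    have hx : ι x.2.2 ∈ U := by
      have : x.2.2 ∈ U.comap ι := htop ▸ Submodule.mem_top
      exact this
    have : x = (x.1 - x.2.1) • (1, 0) + x.2.1 • (1, 1, 0) + ι x.2.2 := by
      ext <;> simp [ι]
    rw [this]
    exact U.add_mem (U.add_mem (U.smul_mem _ h1) (U.smul_mem _ h11)) hx
  · rw [map_mul, Module.End.mul_apply]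
    have : aeval (P' * Q') (X ^ 2 - C τ * X + C (π * κ)) (1, 0) = (P' * Q') (ι e) := by
      rw [map_add, map_sub, map_mul, map_pow, aeval_C, aeval_C, aeval_X, LinearMap.add_apply,
        LinearMap.sub_apply, pow_two, Module.End.mul_apply (P' * Q'),
        Module.End.mul_apply _ (P' * Q'), Module.algebraMap_end_apply,
        Module.algebraMap_end_apply, hA1, hA2]
      abel
    rw [this, ← hι, aeval_apply_of_intertwine ι hι,
      aeval_apply_of_intertwine (P * Q) (fun _ => rfl), hpe, map_zero, map_zero]

lemma HasFixedModel.hasModel_X_sub_C_mul {a b : Bool} {p : F[X]} (hp : p.Monic)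
    (h : HasFixedModel a b p) {δ : F} (hδ : IsFactor a δ) :
    HasModel a b (p * (X - C (blockSign F b * δ))) := by
  obtain ⟨V, _, _, _, P, Q, e, hd, hP, hQ, hQe, hc, hpe⟩ := h
  set κ := blockSign F b with hκ
  let P' : End F (F × V) := blockEnd δ 0 0 P
  let Q' : End F (F × V) := blockEnd κ 0 e Q
  have hP' : IsFactor a P' := isFactor_blockEnd_lower hδ hP (by simp)
  have hQ' : IsFactor b Q' := isFactor_blockEnd_lower (isFactor_blockSign b) hQ
    (by rw [blockSign_mul_self, one_smul, hQe])
  let ι : V →ₗ[F] F × V := LinearMap.inr F F V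
  have hι : ∀ v, ι ((P * Q) v) = (P' * Q') (ι v) := fun v => by simp [ι, P', Q']
  have hA1 : (P' * Q') (1, 0) = (κ * δ) • (1, 0) + (P' * Q') (ι e) := by
    simp [P', Q', ι, hQe, mul_comm]
  have hinj : Function.Injective (P' * Q') := hP'.injective.comp hQ'.injective
  refine ⟨F × V, _, _, inferInstance, P' * Q', (1, 0), ?_,
    hasFactorization_pair.2 ⟨P', Q', hP', hQ', rfl⟩, fun U h1 hU => ?_, ?_⟩
  · rw [hp.natDegree_mul (monic_X_sub_C _), natDegree_X_sub_C, finrank_prod, finrank_self, hd]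
    ring
  · have h12 : (P' * Q') (ι e) ∈ U := by
      have := hU _ h1
      rw [hA1] at this
      exact (U.add_mem_iff_right (U.smul_mem _ h1)).1 this
    have htop : U.comap ι = ⊤ := hc _ (mem_of_apply_mem hinj hU h12) fun x hx => by
      simpa only [Submodule.mem_comap, hι] using hU _ hx
    refine eq_top_iff.2 fun x _ => ?_
    have hx : ι x.2 ∈ U := by
      have : x.2 ∈ U.comap ι := htop ▸ Submodule.mem_top
      exact this
    have : x = x.1 • (1, 0) + ι x.2 := by ext <;> simp [ι]
    rw [this]
    exact U.add_mem (U.smul_mem _ h1) hx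
  · have : aeval (P' * Q') (X - C (κ * δ)) (1, 0) = (P' * Q') (ι e) := by
      rw [map_sub, aeval_X, aeval_C, LinearMap.sub_apply, hA1, Module.algebraMap_end_apply]
      abel
    rw [map_mul, Module.End.mul_apply, this, ← hι, aeval_apply_of_intertwine ι hι,
      aeval_apply_of_intertwine (P * Q) (fun _ => rfl), hpe, map_zero, map_zero]

end Model

section ModelProducts

universe u

variable {F : Type u} [Field F]

lemma HasFixedModel.mul_prod {a b : Bool} {q : F[X]} (hq : q.Monic) (h : HasFixedModel a b q)
    {z : ℕ → F} (hz : ∀ i, z (2 * i) * z (2 * i + 1) = blockSign F a * blockSign F b) (m : ℕ) :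
    HasFixedModel a b (q * ∏ t ∈ Finset.range (2 * m), (X - C (z t))) := by
  induction m with
  | zero => simpa using h
  | succ m ih =>
    have hpair : (X - C (z (2 * m))) * (X - C (z (2 * m + 1))) =
        X ^ 2 - C (z (2 * m) + z (2 * m + 1)) * X + C (blockSign F a * blockSign F b) := by
      rw [← hz m, C_mul, C_add]
      ring
    rw [show 2 * (m + 1) = 2 * m + 1 + 1 by ring, Finset.prod_range_succ, Finset.prod_range_succ,
      mul_assoc (∏ t ∈ _, _), ← mul_assoc q, hpair]
    exact ih.pair (hq.mul (monic_prod_X_sub_C _ _)) _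

lemma hasModel_prod_of_mul_eq_one (b : Bool) {z : ℕ → F} {n : ℕ}
    (hz : ∀ i, z (2 * i) * z (2 * i + 1) = 1) (hn : Odd n → z (n - 1) = 1) :
    HasModel b b (∏ t ∈ Finset.range n, (X - C (z t))) := by
  have hz' : ∀ i, z (2 * i) * z (2 * i + 1) = blockSign F b * blockSign F b := by
    simpa [blockSign_mul_self] using hz
  obtain ⟨m, rfl | rfl⟩ := Nat.even_or_odd' n
  · simpa using ((hasFixedModel_one b b).mul_prod monic_one hz' m).hasModel
  · have h1 : z (2 * m) = 1 := hn (odd_two_mul_add_one m)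
    rw [Finset.prod_range_succ, h1, mul_comm]
    exact ((hasFixedModel_X_sub_C b (isFactor_one b)).mul_prod (monic_X_sub_C _) hz' m).hasModel

lemma hasModel_true_prod (b : Bool) {r : ℕ → F} {n : ℕ} (hn : 0 < n) (h0 : r 0 * r 0 = 1)
    (hr : ∀ i, r (2 * i + 1) * r (2 * i + 2) = blockSign F true * blockSign F b)
    (hlast : Even n → r (n - 1) * r (n - 1) = 1) :
    HasModel true b (∏ t ∈ Finset.range n, (X - C (r t))) := by
  have hδ : IsFactor true (blockSign F b * r 0) := by
    change _ * _ = _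
    rw [mul_mul_mul_comm, blockSign_mul_self, h0, one_mul]
  have hr0 : r 0 = blockSign F b * (blockSign F b * r 0) := by
    rw [← mul_assoc, blockSign_mul_self, one_mul]
  obtain ⟨n, rfl⟩ := Nat.exists_eq_succ_of_ne_zero hn.ne'
  rw [Nat.succ_eq_add_one, Finset.prod_range_succ', hr0]
  refine HasFixedModel.hasModel_X_sub_C_mul (monic_prod_X_sub_C _ _) ?_ hδ
  obtain ⟨m, rfl | rfl⟩ := Nat.even_or_odd' n
  · simpa using (hasFixedModel_one true b).mul_prod monic_one (z := fun i => r (i + 1)) hr m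
  · have h1 : IsFactor true (r (2 * m + 1)) := hlast (by simp [Nat.even_add_one])
    rw [Finset.prod_range_succ, mul_comm]
    exact (hasFixedModel_X_sub_C b h1).mul_prod (monic_X_sub_C _) (z := fun i => r (i + 1)) hr m

variable {V : Type*} [AddCommGroup V] [Module F V] [FiniteDimensional F V]

lemma HasModel.exists_end {a b : Bool} {p : F[X]} (h : HasModel a b p)
    (hV : finrank F V = p.natDegree) :
    ∃ (A : End F V) (v : V), HasFactorization [a, b] A ∧ IsCyclicVector A v ∧
      aeval A p v = 0 := by
  obtain ⟨W, _, _, _, A, e, hd, hA, hc, hp⟩ := h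
  let E : W ≃ₗ[F] V := LinearEquiv.ofFinrankEq _ _ (hd.trans hV.symm)
  refine ⟨E.conjRingEquiv A, E e, hA.map E.conjRingEquiv.toRingHom, hc.equiv E, ?_⟩
  have := aeval_apply_of_intertwine (A := A) (B := E.conjRingEquiv A) E.toLinearMap
    (fun x => by simp) p e
  simpa [hp] using this

lemma HasModel.hasFactorization {a b : Bool} {p : F[X]} (h : HasModel a b p) (hp : p.Monic)
    (hV : finrank F V = p.natDegree) {A : End F V} {v : V} (hc : IsCyclicVector A v)
    (hA : aeval A p v = 0) : HasFactorization [a, b] A := by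
  obtain ⟨W, _, _, _, B, e, hd, hB, hcB, hpB⟩ := h
  obtain ⟨E, -, hE⟩ := exists_equiv_of_isCyclicVector hcB hc hp hd hV hpB hA
  have : A = E.conjRingEquiv B := LinearMap.ext fun x => by
    simp [hE]
  exact this ▸ hB.map E.conjRingEquiv.toRingHom

/-- Unipotent endomorphisms are products of two involutions, and of two U2-endomorphisms. -/
lemma hasFactorization_of_isNilpotent_sub_one (b : Bool) {L : End F V}
    (hL : IsNilpotent (L - 1)) : HasFactorization [b, b] L := by
  have hirr : Irreducible (X - C 1 : F[X]) := irreducible_X_sub_C 1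
  have htors : IsTorsion' (AEval' L) (Submonoid.powers (X - C 1 : F[X])) := by
    obtain ⟨k, hk⟩ := hL
    refine fun x => ⟨⟨(X - C 1) ^ k, k, rfl⟩, ?_⟩
    change (AEval'.of L) (aeval L ((X - C 1) ^ k) • (AEval'.of L).symm x) = 0
    simp [hk]
  obtain ⟨d, k, ⟨E⟩⟩ := torsion_by_prime_power_decomposition hirr htors
  let Q : Fin d → Type _ := fun i => F[X] ⧸ Submodule.span F[X] {(X - C 1 : F[X]) ^ k i}
  let e : V ≃ₗ[F] (∀ i, Q i) := (AEval'.of L).trans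
    ((E.restrictScalars F).trans (DirectSum.linearEquivFunOnFintype F (Fin d) Q))
  have he : ∀ x i, e (L x) i = (X : F[X]) • e x i := by
    intro x i
    change E (AEval'.of L (L x)) i = _
    rw [← AEval'.X_smul_of, map_smul]
    rfl
  have hfac : ∀ i, HasFactorization [b, b] (Algebra.lsmul F F (Q i) (X : F[X])) := by
    intro i
    have hmonic : ((X - C 1 : F[X]) ^ k i).Monic := (monic_X_sub_C 1).pow _
    have hfin : Module.Finite F (Q i) := hmonic.finite_quotient
    have hmodel : HasModel b b ((X - C 1 : F[X]) ^ k i) := by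
      have := hasModel_prod_of_mul_eq_one (F := F) b (z := fun _ => 1) (n := k i)
        (fun _ => one_mul 1) (fun _ => rfl)
      simpa using this
    have hlsmul : ∀ p : F[X], aeval (Algebra.lsmul F F (Q i) (X : F[X])) p
        (Submodule.Quotient.mk 1) = Submodule.Quotient.mk p := by
      intro p
      rw [aeval_algHom_apply, aeval_X_left_apply]
      change Submodule.Quotient.mk (p • 1) = _
      rw [smul_eq_mul, mul_one]
    refine hmodel.hasFactorization hmonic finrank_quotient_span_eq_natDegree
      (v := Submodule.Quotient.mk 1) (fun U h1 hU => ?_) ?_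
    · refine eq_top_iff.2 fun x _ => ?_
      obtain ⟨p, rfl⟩ := Submodule.Quotient.mk_surjective _ x
      exact hlsmul p ▸ aeval_mem_of_invariant hU h1 p
    · rw [hlsmul, Submodule.Quotient.mk_eq_zero]
      exact Submodule.mem_span_singleton_self _
  simp only [hasFactorization_pair] at hfac
  choose P R hP hR hPR using hfac
  have hpi : ∀ T : ∀ i, End F (Q i), (∀ i, IsFactor b (T i)) →
      IsFactor b (LinearMap.pi fun i => T i ∘ₗ LinearMap.proj i : End F (∀ i, Q i)) := by
    intro T hT
    cases b
    · refine LinearMap.ext fun x => funext fun i => ?_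
      exact LinearMap.congr_fun (hT i) (x i)
    · refine LinearMap.ext fun x => funext fun i => ?_
      exact LinearMap.congr_fun (hT i) (x i)
  have hL' : L = e.symm.conjRingEquiv ((LinearMap.pi fun i => P i ∘ₗ LinearMap.proj i) *
      (LinearMap.pi fun i => R i ∘ₗ LinearMap.proj i)) := by
    refine LinearMap.ext fun x => e.injective (funext fun i => ?_)
    rw [he]
    simpa using (LinearMap.congr_fun (hPR i) (e x i)).symm
  rw [hL']
  exact HasFactorization.map (hasFactorization_pair.2 ⟨_, _, hpi P hP, hpi R hR, rfl⟩)
    e.symm.conjRingEquiv.toRingHom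

/-- A nonscalar automorphism of determinant `±1` is a product of an involution and three other
factors, the last two of which are of the same type. -/
lemma hasFactorization_of_notMem (b κ : Bool) {M : End F V} (hM : Function.Injective M)
    (hdet : LinearMap.det M = 1 ∨ LinearMap.det M = -1) {e : V} (he : M e ∉ F ∙ e) :
    HasFactorization [true, b, κ, κ] M := by
  have hdet' : LinearMap.det M * LinearMap.det M = 1 := by rcases hdet with h | h <;> simp [h]
  have hpos : 0 < finrank F V := by
    have : Nontrivial V := ⟨M e, 0, fun h => he (h ▸ Submodule.zero_mem _)⟩
    exact finrank_pos
  set c := blockSign F true * blockSign F b with hc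
  have hcc : c * c = 1 := by
    rw [hc, mul_mul_mul_comm, blockSign_mul_self, blockSign_mul_self, one_mul]
  obtain ⟨n, hn⟩ := Nat.exists_eq_succ_of_ne_zero hpos.ne'
  let s : ℕ → F := fun i => if Even i then 1 else c
  let w := ∏ t ∈ Finset.range n, s t
  have hw : w * w = 1 := by
    rw [← Finset.prod_mul_distrib]
    refine Finset.prod_eq_one fun i _ => ?_
    dsimp [s]
    split_ifs <;> simp [hcc]
  let r : ℕ → F := fun i => Nat.casesOn i (w * LinearMap.det M) s
  have hmodel : HasModel true b (∏ t ∈ Finset.range (n + 1), (X - C (r t))) := by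
    refine hasModel_true_prod b n.succ_pos ?_ (fun i => ?_) (fun h => ?_)
    · change w * _ * (w * _) = 1
      rw [mul_mul_mul_comm, hw, hdet', one_mul]
    · simp [r, s, hc]
    · cases n with
      | zero => simp at h
      | succ n =>
        have : Even n := by simpa [Nat.even_add_one] using h
        simp [r, s, this]
  have hmonic : (∏ t ∈ Finset.range (n + 1), (X - C (r t))).Monic := monic_prod_X_sub_C _ _
  have hdeg : (∏ t ∈ Finset.range (n + 1), (X - C (r t))).natDegree = finrank F V := by
    rw [natDegree_prod_of_monic _ _ fun i _ => monic_X_sub_C _]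
    simp [hn]
  obtain ⟨L, hL, v, hv, hp⟩ := exists_unipotent_aeval_eq_zero hM he hmonic hdeg (by
    rw [coeff_zero_eq_eval_zero, eval_prod, Finset.prod_range_succ']
    simp only [eval_sub, eval_X, eval_C, zero_sub, Finset.prod_neg]
    change (_ * w) * -(w * _) = _
    rw [hn]
    simp
    linear_combination (- (-1) ^ n * LinearMap.det M) * hw)
  have hR := hmodel.hasFactorization hmonic hdeg.symm hv hp
  have hLb := hasFactorization_of_isNilpotent_sub_one κ hL
  obtain ⟨L', hL'⟩ : ∃ L', L * L' = 1 := by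
    have : IsUnit L := by simpa using hL.isUnit_add_one
    exact this.exists_right_inv
  have := hR.append (hLb.inverse_pair hL')
  rwa [mul_assoc, hL', mul_one] at this

end ModelProducts

section Scalar

variable {F V : Type*} [Field F] [AddCommGroup V] [Module F V] [FiniteDimensional F V]

/-- The polynomial annihilating `μ • L⁻¹` obtained from one annihilating `L`. -/
lemma exists_aeval_smul_inverse {L L' : End F V} (h : L * L' = 1) (μ : F) {z : ℕ → F}
    (hz : ∀ t, z t ≠ 0) (n : ℕ) :
    ∃ T : End F V, Commute T L ∧
      aeval (μ • L') (∏ t ∈ Finset.range n, (X - C (μ / z t))) =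
        T * aeval L (∏ t ∈ Finset.range n, (X - C (z t))) := by
  have h' : L' * L = 1 := mul_eq_one_comm.1 h
  induction n with
  | zero => exact ⟨1, Commute.one_left _, by simp⟩
  | succ n ih =>
    obtain ⟨T, hT, hn⟩ := ih
    refine ⟨-(μ / z n) • (L' * T), ((Commute.mul_left (h'.trans h.symm) hT).smul_left _), ?_⟩
    have hstep : μ • L' - algebraMap F (End F V) (μ / z n) =
        -(μ / z n) • (L' * (L - algebraMap F (End F V) (z n))) := by
      rw [mul_sub, h', Algebra.algebraMap_eq_smul_one, Algebra.algebraMap_eq_smul_one,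
        mul_smul_comm, mul_one, smul_sub, smul_smul, neg_mul, div_mul_cancel₀ _ (hz n)]
      module
    have hcomm : (L - algebraMap F (End F V) (z n)) * T = T * (L - algebraMap F (End F V) (z n)) :=
      (hT.symm.sub_left (Algebra.commute_algebraMap_left _ _)).eq
    rw [Finset.prod_range_succ, Finset.prod_range_succ, mul_comm, map_mul, hn,
      mul_comm (∏ t ∈ _, _), map_mul]
    simp only [map_sub, aeval_X, aeval_C, hstep, smul_mul_assoc]
    rw [← mul_assoc, mul_assoc L', hcomm]
    simp only [mul_assoc]

lemma hasFactorization_smul_one_of_odd (b κ : Bool) (hV : 0 < finrank F V) {μ : F}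
    (hμ : μ ^ finrank F V * μ ^ finrank F V = 1)
    (hodd : ∀ m, finrank F V = 2 * m + 1 →
      (blockSign F true * blockSign F b) ^ m * μ ^ finrank F V = 1) :
    HasFactorization [true, b, κ, κ] (μ • (1 : End F V)) := by
  set n := finrank F V with hn
  set c := blockSign F true * blockSign F b with hc
  have hcc : c * c = 1 := by
    rw [hc, mul_mul_mul_comm, blockSign_mul_self, blockSign_mul_self, one_mul]
  have hc0 : c ≠ 0 := left_ne_zero_of_mul_eq_one hcc
  have hμ0 : μ ≠ 0 := by
    rintro rfl
    simp [hV.ne'] at hμ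
  let y : ℕ → F := fun i => c ^ i * μ ^ (2 * i + 1)
  have hy : ∀ i, y i ≠ 0 := fun i => mul_ne_zero (pow_ne_zero _ hc0) (pow_ne_zero _ hμ0)
  let z : ℕ → F := fun t => if Even t then y (t / 2) else (y (t / 2))⁻¹
  have hz0 : ∀ i, z (2 * i) = y i := fun i => by simp [z]
  have hz1 : ∀ i, z (2 * i + 1) = (y i)⁻¹ := fun i => by
    simp [z, show (2 * i + 1) / 2 = i by omega]
  have hz : ∀ t, z t ≠ 0 := fun t => by
    dsimp [z]
    split_ifs
    · exact hy _
    · exact inv_ne_zero (hy _)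
  have hdeg : ∀ w : ℕ → F, (∏ t ∈ Finset.range n, (X - C (w t))).natDegree = n := fun w => by
    rw [natDegree_prod_of_monic _ _ fun i _ => monic_X_sub_C _]
    simp
  have hmodel := hasModel_prod_of_mul_eq_one κ (z := z) (n := n)
    (fun i => by rw [hz0, hz1, mul_inv_cancel₀ (hy i)]) (fun ⟨m, hm⟩ => by
      rw [hm, Nat.add_sub_cancel, hz0, ← hodd m hm, hm])
  obtain ⟨L, v, hL, hv, hp⟩ := hmodel.exists_end (V := V) (hdeg z).symm
  obtain ⟨L', hL'⟩ := hL.isUnit.exists_right_inv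
  have hmodel' := hasModel_true_prod b (r := fun t => μ / z t) hV
    (by have := hz0 0
        simp [this, y, hμ0])
    (fun i => by
      have hyi : y (i + 1) = c * μ ^ 2 * y i := by
        simp only [y]
        ring
      rw [hz1, show 2 * i + 2 = 2 * (i + 1) by ring, hz0, hyi, div_inv_eq_mul, ← hc]
      have hyi0 := hy i
      field_simp
      rw [sq, hcc]) (fun ⟨m, hm⟩ => by
      obtain ⟨k, rfl⟩ : ∃ k, m = k + 1 := ⟨m - 1, by omega⟩
      have hyk : μ * y k = c ^ k * μ ^ n := by
        simp only [y, hm]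
        ring
      rw [show n - 1 = 2 * k + 1 by omega, hz1, div_inv_eq_mul, hyk, mul_mul_mul_comm, hμ,
        ← mul_pow, hcc, one_pow, mul_one])
  obtain ⟨T, -, hT⟩ := exists_aeval_smul_inverse hL' μ hz n
  have hR : HasFactorization [true, b] (μ • L') :=
    hmodel'.hasFactorization (monic_prod_X_sub_C _ _) (hdeg _).symm
      ((hv.inverse hL').smul hμ0) (by rw [hT, Module.End.mul_apply, hp, map_zero])
  have := hR.append hL
  rwa [smul_mul_assoc, mul_eq_one_comm.1 hL'] at this

lemma hasFactorization_smul_one (b κ : Bool) (hV : 0 < finrank F V) {μ : F}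
    (hμ : μ ^ finrank F V * μ ^ finrank F V = 1) :
    HasFactorization [true, b, κ, κ] (μ • (1 : End F V)) := by
  by_cases h : ∀ m, finrank F V = 2 * m + 1 →
      (blockSign F true * blockSign F b) ^ m * μ ^ finrank F V = 1
  · exact hasFactorization_smul_one_of_odd b κ hV hμ h
  · push Not at h
    obtain ⟨m, hm, h⟩ := h
    have hneg : (-μ) ^ finrank F V = -μ ^ finrank F V := Odd.neg_pow ⟨m, hm⟩ μ
    have := (hasFactorization_smul_one_of_odd (V := V) b κ hV (μ := -μ)
      (by rw [hneg, neg_mul_neg, hμ]) fun m' hm' => ?_).neg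
    · simpa using this
    · obtain rfl : m' = m := by omega
      rw [hneg, mul_neg]
      have hsq : ((blockSign F true * blockSign F b) ^ m' * μ ^ finrank F V) *
          ((blockSign F true * blockSign F b) ^ m' * μ ^ finrank F V) = 1 := by
        rw [mul_mul_mul_comm, hμ, ← mul_pow, mul_mul_mul_comm, blockSign_mul_self,
          blockSign_mul_self, one_mul, one_pow, one_mul]
      rw [(mul_self_eq_one_iff.1 hsq).resolve_left h, neg_neg]

/-- Every automorphism of determinant `±1` is a product of an involution and three other
factors, the last two of which are of the same type. -/
lemma hasFactorization_of_det (b κ : Bool) (hV : 0 < finrank F V) {M : End F V}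
    (hdet : LinearMap.det M = 1 ∨ LinearMap.det M = -1) :
    HasFactorization [true, b, κ, κ] M := by
  by_cases h : ∃ e, M e ∉ F ∙ e
  · obtain ⟨e, he⟩ := h
    refine hasFactorization_of_notMem b κ (LinearMap.ker_eq_bot.1 ?_) hdet he
    refine (LinearMap.isUnit_iff_ker_eq_bot M).1 ((LinearMap.isUnit_iff_isUnit_det M).2 ?_)
    rcases hdet with h | h <;> simp [h]
  · push Not at h
    obtain ⟨μ, rfl⟩ := M.exists_eq_smul_id_of_forall_notLinearIndependent fun v hv => by
      obtain ⟨a, ha⟩ := Submodule.mem_span_singleton.1 (h v)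
      have := LinearIndependent.pair_iff.1 hv a (-1) (by rw [ha]; simp)
      exact one_ne_zero (neg_eq_zero.1 this.2)
    refine hasFactorization_smul_one b κ hV ?_
    have : LinearMap.det (μ • (1 : End F V)) = μ ^ finrank F V := by simp
    rw [this] at hdet
    rcases hdet with h | h <;> simp [h]

end Scalar

/-- **Length-4 problem in `GLₙ(F)` with at least one involution.**
Let `F` be a field, `n` a positive integer, `k ∈ {1, 2, 3, 4}`, and let `s` be any prescribed
set of `k` positions (among the four) for the involutory factors. A matrix `M ∈ GLₙ(F)` is a
product of four matrices, those at positions in `s` being involutions and the others being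
U2-matrices, if and only if `det M = ±1`. -/
theorem stmt4 {F : Type*} [Field F] {n : ℕ} (hn : 0 < n)
    (k : ℕ) (hk : k ∈ ({1, 2, 3, 4} : Set ℕ))
    (M : Matrix (Fin n) (Fin n) F) (hM : IsUnit M)
    (s : Finset (Fin 4)) (hs : s.card = k) :
    (∃ B : Fin 4 → Matrix (Fin n) (Fin n) F,
        (∀ j ∈ s, B j * B j = 1) ∧
        (∀ j ∉ s, (B j - 1) * (B j - 1) = 0) ∧
        M = B 0 * B 1 * B 2 * B 3) ↔
      (M.det = 1 ∨ M.det = -1) := by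
  constructor
  · rintro ⟨B, hB, hB', rfl⟩
    have hdet : ∀ j, (B j).det = 1 ∨ (B j).det = -1 := by
      intro j
      have : IsFactor (decide (j ∈ s)) (B j) := by
        by_cases hj : j ∈ s
        · rw [decide_eq_true hj]
          exact hB j hj
        · rw [decide_eq_false hj]
          exact hB' j hj
      have h := (this.map (Matrix.toLinAlgEquiv' (R := F) (n := Fin n)).toRingEquiv.toRingHom).det
      change LinearMap.det (Matrix.toLin' (B j)) = 1 ∨ LinearMap.det (Matrix.toLin' (B j)) = -1 at h
      rwa [LinearMap.det_toLin'] at h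
    rcases hdet 0 with h0 | h0 <;> rcases hdet 1 with h1 | h1 <;> rcases hdet 2 with h2 | h2 <;>
      rcases hdet 3 with h3 | h3 <;> simp [h0, h1, h2, h3]
  · intro h
    have hs : s.Nonempty := by
      rw [← Finset.card_pos, hs]
      rcases hk with rfl | rfl | rfl | rfl <;> norm_num
    have hperm : ∀ s : Finset (Fin 4), s.Nonempty → ∃ b κ : Bool, [true, b, κ, κ].Perm
        [decide (0 ∈ s), decide (1 ∈ s), decide (2 ∈ s), decide (3 ∈ s)] := by
      decide
    obtain ⟨b, κ, hp⟩ := hperm s hs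
    have hfac : HasFactorization [true, b, κ, κ] M := by
      have := (hasFactorization_of_det (V := Fin n → F) b κ (by simpa using hn)
        (M := Matrix.toLin' M) (by simpa using h)).map
          (Matrix.toLinAlgEquiv' (R := F) (n := Fin n)).symm.toRingEquiv.toRingHom
      change HasFactorization _ (LinearMap.toMatrix' (Matrix.toLin' M)) at this
      rwa [LinearMap.toMatrix'_toLin'] at this
    obtain ⟨xs, hxs, rfl⟩ := hfac.perm hp
    rcases hxs with _ | ⟨h0, _ | ⟨h1, _ | ⟨h2, _ | ⟨h3, _ | _⟩⟩⟩⟩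
    rename_i x0 x1 x2 x3
    have hall : ∀ j, IsFactor (decide (j ∈ s)) (![x0, x1, x2, x3] j) := by
      intro j
      fin_cases j <;> assumption
    refine ⟨![x0, x1, x2, x3], fun j hj => ?_, fun j hj => ?_, ?_⟩
    · have := hall j
      rwa [decide_eq_true hj] at this
    · have := hall j
      rwa [decide_eq_false hj] at this
    · simp [mul_assoc]
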